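/- Let σ > 0, F ∈ [0,1), x ∈ [0,1), and let N ≥ 2 be an integer. The tail of the wrapped Gaussian step density series is bounded by a complementary error function: | f_s(x) − (1/√(2πσ²)) · Σ_{i=−N}^{N} exp(−(x − F + i)²/(2σ²)) | ≤ erfc((N − 1)/(σ√2)). -/

import Mathlib

open MeasureTheory Real Set

/-- The wrapped Gaussian step density `f_s` with frequency `F` and variance `v`. -/
noncomputable def stepDensity (F v : ℝ) (x : ℝ) : ℝ :=
  (1 / Real.sqrt (2 * Real.pi * v)) * ∑' i : ℤ, Real.exp (-(x - F + (i : ℝ))^2 / (2 * v))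

/-- The error function `erf(t) = (2/√π) ∫_0^t exp(−u²) du`. -/
noncomputable def erf (t : ℝ) : ℝ :=
  (2 / Real.sqrt Real.pi) * ∫ u in (0:ℝ)..t, Real.exp (-u^2)

/-- The complementary error function `erfc(t) = 1 − erf(t)`. -/
noncomputable def erfc (t : ℝ) : ℝ := 1 - erf t

lemma erf_le_one {t : ℝ} (ht : 0 ≤ t) : erf t ≤ 1 := by
  have hint : Integrable fun u : ℝ => Real.exp (-u ^ 2) := by
    simpa using integrable_exp_neg_mul_sq (b := 1) one_pos
  have h : ∫ u in (0:ℝ)..t, Real.exp (-u ^ 2) ≤ Real.sqrt Real.pi / 2 := by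
    calc ∫ u in (0:ℝ)..t, Real.exp (-u ^ 2)
        = ∫ u in Ioc 0 t, Real.exp (-u ^ 2) := intervalIntegral.integral_of_le ht
      _ ≤ ∫ u in Ioi (0:ℝ), Real.exp (-u ^ 2) :=
        setIntegral_mono_set hint.integrableOn
          (Filter.Eventually.of_forall fun u => (Real.exp_pos _).le)
          Ioc_subset_Ioi_self.eventuallyLE
      _ = Real.sqrt Real.pi / 2 := by simpa using integral_gaussian_Ioi 1
  have hpi : 0 < Real.sqrt Real.pi := Real.sqrt_pos.2 Real.pi_pos
  calc erf t ≤ 2 / Real.sqrt Real.pi * (Real.sqrt Real.pi / 2) :=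
        mul_le_mul_of_nonneg_left h (by positivity)
    _ = 1 := by field_simp

lemma erf_sub_erf (s t : ℝ) :
    erf t - erf s = 2 / Real.sqrt Real.pi * ∫ u in s..t, Real.exp (-u ^ 2) := by
  have hint (a b : ℝ) : IntervalIntegrable (fun u : ℝ => Real.exp (-u ^ 2)) volume a b :=
    (by fun_prop : Continuous fun u : ℝ => Real.exp (-u ^ 2)).intervalIntegrable a b
  rw [erf, erf, ← mul_sub, intervalIntegral.integral_interval_sub_left (hint _ _) (hint _ _)]

lemma gaussian_integral_le_erfc {σ : ℝ} (hσ : 0 < σ) {a b : ℝ} (hb : 0 ≤ b) :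
    1 / Real.sqrt (2 * Real.pi * σ ^ 2) * (2 * ∫ u in a..b, Real.exp (-u ^ 2 / (2 * σ ^ 2)))
      ≤ erfc (a / (σ * Real.sqrt 2)) := by
  have hc : σ * Real.sqrt 2 ≠ 0 := by positivity
  have hpi : 0 < Real.sqrt Real.pi := Real.sqrt_pos.2 Real.pi_pos
  have hsub : ∫ u in a..b, Real.exp (-u ^ 2 / (2 * σ ^ 2)) = σ * Real.sqrt 2 *
      ∫ u in a / (σ * Real.sqrt 2)..b / (σ * Real.sqrt 2), Real.exp (-u ^ 2) := by
    refine Eq.trans (intervalIntegral.integral_congr fun u _ => ?_)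
      (intervalIntegral.integral_comp_div (fun u : ℝ => Real.exp (-u ^ 2)) hc)
    simp only [div_pow, mul_pow, Real.sq_sqrt zero_le_two, neg_div, mul_comm]
  have hsqrt : Real.sqrt (2 * Real.pi * σ ^ 2) = Real.sqrt 2 * Real.sqrt Real.pi * σ := by
    rw [Real.sqrt_mul (by positivity), Real.sqrt_mul zero_le_two, Real.sqrt_sq hσ.le]
  have herf := erf_sub_erf (a / (σ * Real.sqrt 2)) (b / (σ * Real.sqrt 2))
  have hle := erf_le_one (t := b / (σ * Real.sqrt 2)) (by positivity)
  calc _ = erf (b / (σ * Real.sqrt 2)) - erf (a / (σ * Real.sqrt 2)) := by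
        rw [herf, hsub, hsqrt]; field_simp
    _ ≤ _ := by rw [erfc]; linarith

lemma antitoneOn_exp_neg_sq_div {v : ℝ} (hv : 0 ≤ v) :
    AntitoneOn (fun u : ℝ => Real.exp (-u ^ 2 / (2 * v))) (Ici 0) := by
  intro a ha b _ hab
  have ha' : (0:ℝ) ≤ a := ha
  dsimp only
  gcongr

lemma exp_neg_sq_div_le {v a y : ℝ} (hv : 0 ≤ v) (ha : 0 ≤ a) (h : a ≤ |y|) :
    Real.exp (-y ^ 2 / (2 * v)) ≤ Real.exp (-a ^ 2 / (2 * v)) := by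
  simpa using antitoneOn_exp_neg_sq_div hv ha (abs_nonneg y) h

lemma Int.Icc_neg_succ_succ (m : ℕ) :
    Finset.Icc (-((m + 1 : ℕ) : ℤ)) ((m + 1 : ℕ) : ℤ) =
      insert (-((m + 1 : ℕ) : ℤ)) (insert ((m + 1 : ℕ) : ℤ) (Finset.Icc (-(m : ℤ)) m)) := by
  ext i
  simp only [Finset.mem_insert, Finset.mem_Icc]
  omega

lemma sum_Icc_gaussian_le {v d : ℝ} (hv : 0 ≤ v) (hd : |d| ≤ 1) (N n : ℕ) :
    ∑ i ∈ Finset.Icc (-((N + n : ℕ) : ℤ)) ((N + n : ℕ) : ℤ),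
        Real.exp (-(d + (i : ℝ)) ^ 2 / (2 * v)) ≤
      ∑ i ∈ Finset.Icc (-(N : ℤ)) (N : ℤ), Real.exp (-(d + (i : ℝ)) ^ 2 / (2 * v)) +
        2 * ∑ k ∈ Finset.range n, Real.exp (-((N : ℝ) + k) ^ 2 / (2 * v)) := by
  induction n with
  | zero => simp
  | succ n ih =>
    obtain ⟨hd₁, hd₂⟩ := abs_le.1 hd
    have hpos : Real.exp (-(d + (((N + n + 1 : ℕ) : ℤ) : ℝ)) ^ 2 / (2 * v)) ≤
        Real.exp (-((N : ℝ) + n) ^ 2 / (2 * v)) := by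
      refine exp_neg_sq_div_le hv (by positivity) (le_trans ?_ (le_abs_self _))
      push_cast
      linarith
    have hneg : Real.exp (-(d + ((-((N + n + 1 : ℕ) : ℤ) : ℤ) : ℝ)) ^ 2 / (2 * v)) ≤
        Real.exp (-((N : ℝ) + n) ^ 2 / (2 * v)) := by
      refine exp_neg_sq_div_le hv (by positivity) (le_trans ?_ (neg_le_abs _))
      push_cast
      linarith
    rw [← add_assoc, Int.Icc_neg_succ_succ, Finset.sum_insert, Finset.sum_insert,
      Finset.sum_range_succ]
    · linarith
    · simp only [Finset.mem_Icc]; omega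
    · simp only [Finset.mem_insert, Finset.mem_Icc]; omega

lemma sum_range_gaussian_le_integral {v a : ℝ} (hv : 0 ≤ v) (ha : 1 ≤ a) (n : ℕ) :
    ∑ k ∈ Finset.range n, Real.exp (-(a + k) ^ 2 / (2 * v)) ≤
      ∫ u in (a - 1)..(a - 1 + n), Real.exp (-u ^ 2 / (2 * v)) := by
  have h := AntitoneOn.sum_le_integral (x₀ := a - 1) (a := n)
    ((antitoneOn_exp_neg_sq_div hv).mono fun u hu => (sub_nonneg.2 ha).trans hu.1)
  refine le_of_eq_of_le (Finset.sum_congr rfl fun k _ => ?_) h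
  push_cast
  ring_nf

/-- For `σ > 0`, `F, x ∈ [0,1)` and an integer `N ≥ 2`, the tail
of the wrapped Gaussian step density series is bounded by a complementary error
function:
`|f_s(x) − (1/√(2πσ²))·Σ_{i=−N}^{N} exp(−(x − F + i)²/(2σ²))| ≤ erfc((N − 1)/(σ√2))`. -/
theorem stepDensity_tailcut (σ F x : ℝ) (hσ : 0 < σ)
    (hF : F ∈ Set.Ico (0:ℝ) 1) (hx : x ∈ Set.Ico (0:ℝ) 1) (N : ℕ) (hN : 2 ≤ N) :
    |stepDensity F (σ^2) x
        - (1 / Real.sqrt (2 * Real.pi * σ^2))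
            * ∑ i ∈ Finset.Icc (-(N : ℤ)) (N : ℤ),
                Real.exp (-(x - F + (i : ℝ))^2 / (2 * σ^2))|
      ≤ erfc (((N : ℝ) - 1) / (σ * Real.sqrt 2)) := by
  obtain ⟨hF₀, hF₁⟩ := hF
  obtain ⟨hx₀, hx₁⟩ := hx
  have hd : |x - F| ≤ 1 := abs_le.2 ⟨by linarith, by linarith⟩
  have hN' : (1:ℝ) ≤ N := by exact_mod_cast one_le_two.trans hN
  have hc : 0 < 1 / Real.sqrt (2 * Real.pi * σ ^ 2) := by positivity
  set c := 1 / Real.sqrt (2 * Real.pi * σ ^ 2) with hc_def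
  set f : ℤ → ℝ := fun i => Real.exp (-(x - F + (i : ℝ)) ^ 2 / (2 * σ ^ 2))
  have hf₀ : 0 ≤ f := fun i => (Real.exp_pos _).le
  set E := erfc (((N : ℝ) - 1) / (σ * Real.sqrt 2)) with hE
  have hbound (s : Finset ℤ) :
      ∑ i ∈ s, f i ≤ ∑ i ∈ Finset.Icc (-(N : ℤ)) (N : ℤ), f i + E / c := by
    set n := s.sup Int.natAbs
    have hs : s ⊆ Finset.Icc (-((N + n : ℕ) : ℤ)) ((N + n : ℕ) : ℤ) := by
      intro i hi
      have : i.natAbs ≤ n := Finset.le_sup (f := Int.natAbs) hi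
      rw [Finset.mem_Icc]
      omega
    have hsub := Finset.sum_le_sum_of_subset_of_nonneg hs fun i _ _ => hf₀ i
    have hIcc := sum_Icc_gaussian_le (sq_nonneg σ) hd N n
    have hsum := sum_range_gaussian_le_integral (sq_nonneg σ) hN' n
    have hint := gaussian_integral_le_erfc hσ (a := (N : ℝ) - 1) (b := N - 1 + n)
      (add_nonneg (sub_nonneg.2 hN') n.cast_nonneg)
    rw [← hc_def, ← hE, mul_comm, ← le_div_iff₀ hc] at hint
    linarith
  have hsummable : Summable f := summable_of_sum_le hf₀ hbound
  have hlower := hsummable.sum_le_tsum (Finset.Icc (-(N : ℤ)) (N : ℤ)) fun i _ => hf₀ i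
  have hupper := hsummable.tsum_le_of_sum_le hbound
  rw [stepDensity, ← hc_def, ← mul_sub, abs_of_nonneg (mul_nonneg hc.le (sub_nonneg.2 hlower)),
    mul_comm, ← le_div_iff₀ hc]
  linarith
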